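/- Let A₀ be a finite set, let H be the free group with basis A₀ ∪ {a,b,u,y}, let A ≤ H be the subgroup generated by A₀ ∪ {a,b,u}, let v = a·y·b·y·a·y⁻¹·b·y⁻¹ ∈ H, and let F be the HNN extension F = ⟨H, t | t⁻¹ u t = v⟩ of H along the isomorphism ⟨u⟩ → ⟨v⟩ sending u to v (so F is a free group of rank |A₀| + 4). Then, computing closures in F: acl(A) = acl^∃(A) = H and dcl(A) = dcl^∃(A) = A. -/

import Mathlib

open FirstOrder Filter

/-! Common definitions: the first-order language of groups, algebraic/definable closures,
free products, amalgams, HNN extensions, etc. -/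

/-- Function symbols of the language of groups: `1`, `⁻¹`, `·`. -/
inductive GrpFunc : ℕ → Type
  | one : GrpFunc 0
  | inv : GrpFunc 1
  | mul : GrpFunc 2

/-- The first-order language of groups `L = {·, ⁻¹, 1}` (no relation symbols). -/
def grpLang : FirstOrder.Language := ⟨GrpFunc, fun _ => Empty⟩

/-- Every group is a `grpLang`-structure in the natural way. -/
instance grpStructure (G : Type*) [Group G] : grpLang.Structure G where
  funMap {_} f := match f with
    | .one => fun _ => (1 : G)
    | .inv => fun x => (x 0)⁻¹
    | .mul => fun x => x 0 * x 1
  RelMap {_} r := Empty.elim r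

/-- A formula is existential if it is obtained from a quantifier-free formula by
prefixing existential quantifiers. -/
def IsExistential {L : FirstOrder.Language} {α : Type*} (φ : L.Formula α) : Prop :=
  ∃ (n : ℕ) (ψ : L.BoundedFormula α n), ψ.IsQF ∧ φ = ψ.exs

section ModelTheory

variable (L : FirstOrder.Language) {M : Type*} [L.Structure M]

/-- The algebraic closure of a set of parameters `A` in an `L`-structure `M`:
elements satisfying, together with only finitely many other elements, some formula
with parameters from `A`. -/
def Lacl (A : Set M) : Set M :=
  {b | ∃ φ : L.Formula (↥A ⊕ Fin 1),
    {c : M | φ.Realize (Sum.elim Subtype.val fun _ => c)}.Finite ∧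
    φ.Realize (Sum.elim Subtype.val fun _ => b)}

/-- The definable closure of a set of parameters `A` in an `L`-structure `M`. -/
def Ldcl (A : Set M) : Set M :=
  {b | ∃ φ : L.Formula (↥A ⊕ Fin 1),
    {c : M | φ.Realize (Sum.elim Subtype.val fun _ => c)} = {b}}

/-- The existential algebraic closure of `A` in `M`. -/
def LaclE (A : Set M) : Set M :=
  {b | ∃ φ : L.Formula (↥A ⊕ Fin 1), IsExistential φ ∧
    {c : M | φ.Realize (Sum.elim Subtype.val fun _ => c)}.Finite ∧
    φ.Realize (Sum.elim Subtype.val fun _ => b)}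

/-- The existential definable closure of `A` in `M`. -/
def LdclE (A : Set M) : Set M :=
  {b | ∃ φ : L.Formula (↥A ⊕ Fin 1), IsExistential φ ∧
    {c : M | φ.Realize (Sum.elim Subtype.val fun _ => c)} = {b}}

end ModelTheory

section GroupDefs

variable {G : Type*} [Group G]

/-- Algebraic closure in a group, w.r.t. the language of groups. -/
def acl (A : Set G) : Set G := Lacl grpLang A

/-- Definable closure in a group, w.r.t. the language of groups. -/
def dcl (A : Set G) : Set G := Ldcl grpLang A

/-- Existential algebraic closure in a group. -/
def aclE (A : Set G) : Set G := LaclE grpLang A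

/-- Existential definable closure in a group. -/
def dclE (A : Set G) : Set G := LdclE grpLang A

/-- Restricted algebraic closure: elements with finite orbit under automorphisms
of `G` fixing `A` pointwise. -/
def racl (A : Set G) : Set G :=
  {g | {x : G | ∃ f : G ≃* G, (∀ a ∈ A, f a = a) ∧ f g = x}.Finite}

/-- Restricted definable closure: elements fixed by every automorphism of `G`
fixing `A` pointwise. -/
def rdcl (A : Set G) : Set G :=
  {g | ∀ f : G ≃* G, (∀ a ∈ A, f a = a) → f g = g}

/-- A set of group elements is nonabelian (contains two non-commuting elements). -/
def Nonabelian (A : Set G) : Prop := ∃ x ∈ A, ∃ y ∈ A, x * y ≠ y * x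

/-- `F` is a free group of finite rank. -/
def IsFreeOfFiniteRank (F : Type*) [Group F] : Prop :=
  ∃ n : ℕ, Nonempty (F ≃* FreeGroup (Fin n))

/-- `G` is the internal free product of its subgroups `H` and `K`: the canonical
homomorphism from the abstract free product `H ∗ K` to `G` is an isomorphism. -/
def InternalFreeProduct (H K : Subgroup G) : Prop :=
  Function.Bijective (Monoid.Coprod.lift H.subtype K.subtype)

/-- `G` is freely indecomposable relative to its subgroup `A`. -/
def FreelyIndecomposableRel (A : Subgroup G) : Prop :=
  ¬ ∃ G₁ G₂ : Subgroup G, G₁ ≠ ⊥ ∧ G₂ ≠ ⊥ ∧ A ≤ G₁ ∧ InternalFreeProduct G₁ G₂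

/-- `B` is a free factor of the subgroup `K`: there is `L` such that the canonical
homomorphism from the abstract free product `B ∗ L` to the ambient group is injective
with image exactly `K`. -/
def IsFreeFactorOf (B K : Subgroup G) : Prop :=
  ∃ L : Subgroup G,
    Function.Injective (Monoid.Coprod.lift B.subtype L.subtype) ∧
    (Monoid.Coprod.lift B.subtype L.subtype).range = K

/-- `K'` is the amalgamated free product `K ∗_C B` inside the ambient group `G`:
the canonical homomorphism from the abstract amalgamated product (pushout) of `K` and
`B` over `C` to `G` is injective with image exactly `K'`. -/
def IsAmalgamOf (K B C : Subgroup G) (hCK : C ≤ K) (hCB : C ≤ B) (K' : Subgroup G) : Prop :=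
  ∃ ℓ : Monoid.PushoutI
      (fun i : Bool =>
        (Subgroup.inclusion (show C ≤ cond i K B by cases i <;> assumption) :
          ↥C →* ↥(cond i K B))) →* G,
    (∀ i : Bool, ℓ.comp (Monoid.PushoutI.of i) = (cond i K B).subtype) ∧
    Function.Injective ℓ ∧ ℓ.range = K'

/-- `K'` is the HNN extension of `K` along `φ : C ≃* D` inside the ambient group `G`:
the canonical homomorphism from the abstract HNN extension of `K` along `φ` to `G` is
injective with image exactly `K'` (and is the inclusion on `K`). -/
def IsHNNOf (K : Subgroup G) {C D : Subgroup ↥K} (φ : ↥C ≃* ↥D) (K' : Subgroup G) : Prop :=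
  ∃ ℓ : HNNExtension ↥K C D φ →* G,
    ℓ.comp HNNExtension.of = K.subtype ∧ Function.Injective ℓ ∧ ℓ.range = K'

/-- One constructibility step: `K'` is an amalgamated free product of `K` with some
subgroup over a cyclic subgroup, or an HNN extension of `K` along an isomorphism of two
cyclic subgroups of `K`. -/
def ConstructStep (K K' : Subgroup G) : Prop :=
  (∃ (B C : Subgroup G) (hCK : C ≤ K) (hCB : C ≤ B),
      (∃ c : G, C = Subgroup.zpowers c) ∧ B ≤ K' ∧ K ≤ K' ∧ IsAmalgamOf K B C hCK hCB K')
  ∨ (∃ (C D : Subgroup ↥K) (φ : ↥C ≃* ↥D),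
      (∃ c : ↥K, C = Subgroup.zpowers c) ∧ (∃ d : ↥K, D = Subgroup.zpowers d) ∧ IsHNNOf K φ K')

/-- `B` is constructible from `A` by a finite sequence of amalgamated free products and
HNN-extensions along cyclic subgroups. -/
def ConstructibleFrom (A B : Subgroup G) : Prop := Relation.ReflTransGen ConstructStep A B

/-- The rank of a subgroup: the least cardinality of a generating set. For (subgroups of)
free groups this is the cardinality of a basis. -/
noncomputable def srank (H : Subgroup G) : Cardinal :=
  sInf {c : Cardinal | ∃ S : Set G, Subgroup.closure S = H ∧ c = Cardinal.mk ↥S}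

/-- `M` is a maximal abelian subgroup. -/
def IsMaxAbelian (M : Subgroup G) : Prop :=
  (∀ x ∈ M, ∀ y ∈ M, x * y = y * x) ∧
  ∀ N : Subgroup G, (∀ x ∈ N, ∀ y ∈ N, x * y = y * x) → M ≤ N → M = N

/-- `M` is a maximal abelian subgroup of the subgroup `H`. -/
def IsMaxAbelianIn (M H : Subgroup G) : Prop :=
  M ≤ H ∧ (∀ x ∈ M, ∀ y ∈ M, x * y = y * x) ∧
  ∀ N : Subgroup G, N ≤ H → (∀ x ∈ N, ∀ y ∈ N, x * y = y * x) → M ≤ N → M = N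

/-- `M` is a malnormal subgroup: `gMg⁻¹ ∩ M = 1` for every `g ∉ M`. -/
def Malnormal (M : Subgroup G) : Prop :=
  ∀ g : G, g ∉ M → ∀ x ∈ M, g * x * g⁻¹ ∈ M → x = 1

/-- A group is CSA if every maximal abelian subgroup is malnormal. -/
def IsCSA (G : Type*) [Group G] : Prop := ∀ M : Subgroup G, IsMaxAbelian M → Malnormal M

/-- Every abelian subgroup of `G` is cyclic. -/
def AbelianSubgroupsCyclic (G : Type*) [Group G] : Prop :=
  ∀ H : Subgroup G, (∀ x ∈ H, ∀ y ∈ H, x * y = y * x) → ∃ g : G, H = Subgroup.zpowers g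

/-- `G` is equationally noetherian: every system of equations over `G` in finitely many
variables is equivalent to a finite subsystem. -/
def EqNoetherian (G : Type*) [Group G] : Prop :=
  ∀ n : ℕ, 0 < n → ∀ S : Set (Monoid.Coprod G (FreeGroup (Fin n))),
    ∃ S₀ : Set (Monoid.Coprod G (FreeGroup (Fin n))), S₀ ⊆ S ∧ S₀.Finite ∧
      ∀ f : Monoid.Coprod G (FreeGroup (Fin n)) →* G,
        f.comp Monoid.Coprod.inl = MonoidHom.id G →
        ((∀ s ∈ S₀, f s = 1) ↔ ∀ s ∈ S, f s = 1)

/-- A group homomorphism is elementary w.r.t. the language of groups: it preserves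
and reflects all first-order formulas. -/
def ElementaryEmb {H K : Type*} [Group H] [Group K] (e : H →* K) : Prop :=
  ∀ (n : ℕ) (φ : grpLang.Formula (Fin n)) (v : Fin n → H),
    (φ.Realize fun i => e (v i)) ↔ φ.Realize v

/-- The inclusion of the subgroup `H` is an elementary embedding; i.e. the ambient group
is an elementary extension of `H`. -/
def ElementarySub (H : Subgroup G) : Prop := ElementaryEmb H.subtype

/-- A sequence of homomorphisms is stable. -/
def StableSeq {K H : Type*} [Group K] [Group H] (h : ℕ → (K →* H)) : Prop :=
  ∀ k : K, (∀ᶠ n in Filter.atTop, h n k = 1) ∨ (∀ᶠ n in Filter.atTop, h n k ≠ 1)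

/-- A sequence of homomorphisms has trivial stable kernel. -/
def TrivialStableKernel {K H : Type*} [Group K] [Group H] (h : ℕ → (K →* H)) : Prop :=
  ∀ k : K, (∀ᶠ n in Filter.atTop, h n k = 1) → k = 1

/-- A stable sequence of homomorphisms `g n : D → H` with trivial stable kernel strongly
converges to `D`, where `D` is a subgroup of an extension of the base group `H`, the base
group being embedded via `e`. -/
def StronglyConverges {H Gs : Type*} [Group H] [Group Gs] (e : H →* Gs)
    (D : Subgroup Gs) (g : ℕ → (↥D →* H)) : Prop :=
  StableSeq g ∧ TrivialStableKernel g ∧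
  (∀ (d : ↥D) (b : H), (d : Gs) = e b → ∀ᶠ n in Filter.atTop, g n d = b) ∧
  (∀ (d : ↥D) (b : H), (∃ᶠ n in Filter.atTop, g n d = b) → (d : Gs) = e b)

/-- The ball of radius `r` about the identity in the word metric w.r.t. `S`. -/
def wordBall (S : Set G) (r : ℕ) : Set G :=
  {g | ∃ l : List G, l.length ≤ r ∧ (∀ x ∈ l, x ∈ S ∨ x⁻¹ ∈ S) ∧ l.prod = g}

end GroupDefs

namespace HNNCounterexample

variable (A₀ : Type)

/-- The free group with basis `A₀ ∪ {a, b, u, y}`. -/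
abbrev Base := FreeGroup (A₀ ⊕ Fin 4)

/-- The generator `a`. -/
def a : Base A₀ := FreeGroup.of (Sum.inr 0)

/-- The generator `b`. -/
def b : Base A₀ := FreeGroup.of (Sum.inr 1)

/-- The generator `u`. -/
def u : Base A₀ := FreeGroup.of (Sum.inr 2)

/-- The generator `y`. -/
def y : Base A₀ := FreeGroup.of (Sum.inr 3)

/-- The element `v = a y b y a y⁻¹ b y⁻¹`. -/
def v : Base A₀ := a A₀ * y A₀ * b A₀ * y A₀ * a A₀ * (y A₀)⁻¹ * b A₀ * (y A₀)⁻¹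

/-- The subgroup `A = ⟨A₀, a, b, u⟩` of `H`. -/
def A : Subgroup (Base A₀) :=
  Subgroup.closure ((Set.range fun x : A₀ => FreeGroup.of (Sum.inl x)) ∪ {a A₀, b A₀, u A₀})

/-- The HNN extension `F = ⟨H, t | u^t = v⟩` of `H` along the isomorphism
`⟨u⟩ → ⟨v⟩`, `u ↦ v` (the latter isomorphism being given as `φ`). -/
abbrev Ext (φ : ↥(Subgroup.zpowers (u A₀)) ≃* ↥(Subgroup.zpowers (v A₀))) :=
  HNNExtension (Base A₀) (Subgroup.zpowers (u A₀)) (Subgroup.zpowers (v A₀)) φ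

/-- The canonical embedding of `H` into `F`. -/
def ofH (φ : ↥(Subgroup.zpowers (u A₀)) ≃* ↥(Subgroup.zpowers (v A₀))) :
    Base A₀ →* Ext A₀ φ :=
  HNNExtension.of

end HNNCounterexample

namespace FreeGroup

variable {α : Type*}

/-- The subgroup of the elements of a free group whose reduced words only involve letters
from `s`. -/
def supported [DecidableEq α] (s : Set α) : Subgroup (FreeGroup α) where
  carrier := {g | ∀ l ∈ g.toWord, l.1 ∈ s}
  one_mem' := by simp
  mul_mem' {g h} hg hh l hl := by
    rcases List.mem_append.1 ((toWord_mul_sublist g h).subset hl) with h' | h'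
    exacts [hg l h', hh l h']
  inv_mem' {g} hg l hl := by
    rw [toWord_inv] at hl
    simp only [invRev, List.mem_reverse, List.mem_map] at hl
    obtain ⟨m, hm, rfl⟩ := hl
    exact hg m hm

section Supported

variable {s : Set α}

theorem mem_supported [DecidableEq α] {g : FreeGroup α} :
    g ∈ supported s ↔ ∀ l ∈ g.toWord, l.1 ∈ s := Iff.rfl

theorem of_mem_supported [DecidableEq α] {x : α} (hx : x ∈ s) : of x ∈ supported s := by
  simp [mem_supported, hx]

theorem mk_mem_supported [DecidableEq α] {L : List (α × Bool)} (h : ∀ l ∈ L, l.1 ∈ s) :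
    mk L ∈ supported s := by
  intro l hl
  rw [toWord_mk] at hl
  exact h l ((reduce.red (L := L)).sublist.subset hl)

theorem mk_mem_closure {L : List (α × Bool)} (h : ∀ l ∈ L, l.1 ∈ s) :
    mk L ∈ Subgroup.closure (of '' s) := by
  induction L with
  | nil => exact one_mem _
  | cons x L ih =>
    have : mk (x :: L) = mk [x] * mk L := by simp
    rw [this]
    refine mul_mem ?_ (ih fun l hl => h l (by simp [hl]))
    have hx : of x.1 ∈ Subgroup.closure (of '' s) :=
      Subgroup.subset_closure ⟨_, h x (by simp), rfl⟩
    rcases x with ⟨x, _ | _⟩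
    · simpa [of, inv_mk, invRev] using inv_mem hx
    · exact hx

theorem supported_eq_closure [DecidableEq α] : supported s = Subgroup.closure (of '' s) := by
  refine le_antisymm (fun g hg => ?_) ((Subgroup.closure_le _).2 ?_)
  · rw [← mk_toWord (x := g)]
    exact mk_mem_closure hg
  · rintro _ ⟨x, hx, rfl⟩
    exact of_mem_supported hx

end Supported

theorem IsReduced.invRev {L : List (α × Bool)} (h : IsReduced L) : IsReduced (invRev L) := by
  classical
  rw [isReduced_iff_reduce_eq, reduce_invRev, h.reduce_eq]

theorem IsReduced.eq_of_mk_eq {L₁ L₂ : List (α × Bool)} (h₁ : IsReduced L₁) (h₂ : IsReduced L₂)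
    (h : mk L₁ = mk L₂) : L₁ = L₂ := by
  classical
  rw [← h₁.reduce_eq, ← h₂.reduce_eq, reduce.sound h]

theorem IsReduced.append {L₁ L₂ : List (α × Bool)} (h₁ : IsReduced L₁) (h₂ : IsReduced L₂)
    (h : ∀ x ∈ L₁.getLast?, ∀ y ∈ L₂.head?, x.1 = y.1 → x.2 = y.2) : IsReduced (L₁ ++ L₂) :=
  List.isChain_append.2 ⟨h₁, h₂, h⟩

theorem mk_append (L₁ L₂ : List (α × Bool)) : mk (L₁ ++ L₂) = mk L₁ * mk L₂ := mul_mk.symm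

theorem mk_cons (x : α × Bool) (L : List (α × Bool)) : mk (x :: L) = mk [x] * mk L :=
  mk_append [x] L

theorem IsCyclicallyReduced.rotate_one {x : α × Bool} {L : List (α × Bool)}
    (h : IsCyclicallyReduced (x :: L)) : IsCyclicallyReduced (L ++ [x]) := by
  obtain ⟨h1, h2⟩ := h
  rcases L with _ | ⟨z, L⟩
  · simp
  · have h1' := (isReduced_cons_cons.1 h1)
    refine ⟨h1'.2.append IsReduced.singleton ?_, ?_⟩
    · intro w hw v hv
      refine h2 w ?_ v ?_
      · simpa using hw
      · simpa using hv
    · intro w hw v hv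
      rw [List.getLast?_concat] at hw
      simp only [List.cons_append, List.head?_cons, Option.mem_def, Option.some.injEq] at hw hv
      subst hw hv
      exact h1'.1

theorem IsCyclicallyReduced.rotate_last {x : α × Bool} {L : List (α × Bool)}
    (h : IsCyclicallyReduced (L ++ [x])) : IsCyclicallyReduced (x :: L) := by
  obtain ⟨h1, h2⟩ := h
  rcases List.eq_nil_or_concat L with rfl | ⟨L, z, rfl⟩
  · simp
  · refine ⟨IsReduced.append (L₁ := [x]) IsReduced.singleton (h1.infix ⟨[], [x], by simp⟩) ?_, ?_⟩
    · intro w hw v hv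
      refine h2 w ?_ v ?_
      · simpa using hw
      · simp only [List.head?_append]
        rw [List.concat_eq_append] at hv ⊢
        simp only [Option.mem_def, List.head?_append] at hv ⊢
        rw [hv]; rfl
    · intro w hw v hv
      have h3 := (List.isChain_append.1 h1).2.2 w (by simpa [List.getLast?_cons] using hw) v
        (by simpa using hv)
      exact h3

/-- Conjugate cyclically reduced words are cyclic permutations of each other. -/
theorem IsCyclicallyReduced.isRotated_of_isConj {L₁ L₂ : List (α × Bool)}
    (h₁ : IsCyclicallyReduced L₁) (h₂ : IsCyclicallyReduced L₂) (h : IsConj (mk L₁) (mk L₂)) :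
    L₁ ~r L₂ := by
  classical
  obtain ⟨c, hc⟩ := isConj_iff.1 h
  clear h
  obtain ⟨C, hC, rfl⟩ : ∃ C, IsReduced C ∧ mk C = c := ⟨c.toWord, isReduced_toWord, mk_toWord⟩
  induction C using List.reverseRecOn generalizing L₁ with
  | nil =>
    have : mk L₁ = mk L₂ := by simpa [← one_eq_mk] using hc
    rw [h₁.1.eq_of_mk_eq h₂.1 this]
  | append_singleton C x ih =>
    have hC' : IsReduced C := hC.infix ⟨[], [x], by simp⟩
    rw [mk_append] at hc
    rcases L₁ with _ | ⟨z, L⟩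
    · have : mk L₂ = mk [] := by rw [← hc, ← one_eq_mk]; group
      rw [h₂.1.eq_of_mk_eq IsReduced.nil this]
    by_cases hz : z.1 = x.1 ∧ z.2 = !x.2
    · have hzx : mk [z] = (mk [x])⁻¹ := by
        rcases z with ⟨z1, z2⟩
        simp only at hz
        simp [inv_mk, invRev, hz.1, hz.2]
      refine (List.isRotated_append (l := [z]) (l' := L)).trans
        (ih h₁.rotate_one hC' ?_)
      rw [← hc, mk_append, mk_cons z L, hzx]
      group
    · obtain ⟨M, w, hM⟩ : ∃ M w, z :: L = M ++ [w] := by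
        rcases List.eq_nil_or_concat (z :: L) with h | ⟨M, w, h⟩
        · simp at h
        · exact ⟨M, w, by simpa using h⟩
      by_cases hw : w = x
      · subst hw
        rw [hM] at h₁ hc ⊢
        refine (List.isRotated_append (l := M) (l' := [w])).trans
          (ih h₁.rotate_last hC' ?_)
        rw [← hc, mk_append _ M, mk_append M _]
        group
      · exfalso
        have hred : IsReduced ((C ++ [x]) ++ (z :: L) ++ invRev (C ++ [x])) := by
          refine IsReduced.append_overlap ?_ ?_ (by simp)
          · refine hC.append h₁.1 ?_
            intro p hp q hq
            simp at hp hq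
            subst hp hq
            intro h
            by_contra h'
            exact hz ⟨h.symm, by cases hx : x.2 <;> cases hzz : z.2 <;> simp_all⟩
          · refine h₁.1.append hC.invRev ?_
            intro p hp q hq
            rw [hM] at hp
            simp [invRev] at hp hq
            subst hp hq
            intro h
            by_contra h'
            simp only at h h'
            exact hw (Prod.ext h (by cases hx : x.2 <;> cases hzz : w.2 <;> simp_all))
        have heq : (C ++ [x]) ++ (z :: L) ++ invRev (C ++ [x]) = L₂ := by
          refine hred.eq_of_mk_eq h₂.1 ?_
          rw [mk_append, ← inv_mk, mk_append, mk_append, hc]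
        have h3 := h₂.2
        rw [← heq] at h3
        obtain ⟨p, hp⟩ : ∃ p, (C ++ [x]).head? = some p := by
          cases C <;> simp
        have := h3 (p.1, !p.2) (by
          rcases hCx : C ++ [x] with _ | ⟨q, D⟩
          · simp at hCx
          · rw [hCx] at hp
            simp at hp
            subst hp
            rw [show invRev (q :: D) = invRev D ++ [(q.1, !q.2)] by simp [invRev],
              ← List.append_assoc, List.getLast?_concat]
            rfl) p (by rw [List.append_assoc, List.head?_append, hp]; rfl)
        simp at this

end FreeGroup

/-- The element `a x b x a x⁻¹ b x⁻¹` of a group. -/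
def quadWord {G : Type*} [Group G] (a b x : G) : G :=
  a * x * b * x * a * x⁻¹ * b * x⁻¹

theorem map_quadWord {G G' : Type*} [Group G] [Group G'] (f : G →* G') (a b x : G) :
    f (quadWord a b x) = quadWord (f a) (f b) (f x) := by
  simp [quadWord]

theorem isConj_quadWord_inv {G : Type*} [Group G] (a b x : G) :
    IsConj (quadWord a b x⁻¹) (quadWord a b x) :=
  isConj_iff.2 ⟨a * x * b * x, by simp only [quadWord]; group⟩

namespace FreeGroup

variable {α : Type*}

/-- A nonempty reduced word whose first and last letters lie outside `s`. -/
def IsOuter (s : Set α) (L : List (α × Bool)) : Prop :=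
  IsReduced L ∧ (∃ x, L.head? = some x ∧ x.1 ∉ s) ∧ ∃ x, L.getLast? = some x ∧ x.1 ∉ s

/-- A reduced word whose first letter lies outside `s` and whose last letter lies in `s`. -/
def IsMixed (s : Set α) (L : List (α × Bool)) : Prop :=
  IsReduced L ∧ (∃ x, L.head? = some x ∧ x.1 ∉ s) ∧ ∃ x, L.getLast? = some x ∧ x.1 ∈ s

variable {s : Set α} {L L₁ L₂ : List (α × Bool)}

theorem IsMixed.append (h₁ : IsMixed s L₁) (h₂ : IsMixed s L₂) : IsMixed s (L₁ ++ L₂) := by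
  obtain ⟨r₁, ⟨x₁, hx₁, hx₁'⟩, z₁, hz₁, hz₁'⟩ := h₁
  obtain ⟨r₂, ⟨x₂, hx₂, hx₂'⟩, z₂, hz₂, hz₂'⟩ := h₂
  refine ⟨r₁.append r₂ ?_, ⟨x₁, by simp [List.head?_append, hx₁], hx₁'⟩,
    z₂, by simp [List.getLast?_append, hz₂], hz₂'⟩
  rw [hz₁, hx₂]
  rintro _ ⟨⟩ _ ⟨⟩ h
  exact absurd (h ▸ hz₁') hx₂'

theorem IsMixed.isCyclicallyReduced (h : IsMixed s L) : IsCyclicallyReduced L := by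
  obtain ⟨r, ⟨x, hx, hx'⟩, z, hz, hz'⟩ := h
  refine ⟨r, ?_⟩
  rw [hx, hz]
  rintro _ ⟨⟩ _ ⟨⟩ h
  exact absurd (h ▸ hz') hx'

theorem IsOuter.isMixed_append_toWord [DecidableEq α] (h : IsOuter s L) {g : FreeGroup α}
    (hg : g ∈ supported s) (hg1 : g ≠ 1) : IsMixed s (L ++ g.toWord) := by
  obtain ⟨r, ⟨x, hx, hx'⟩, z, hz, hz'⟩ := h
  have hne : g.toWord ≠ [] := by simpa using hg1
  refine ⟨r.append isReduced_toWord ?_, ⟨x, by simp [List.head?_append, hx], hx'⟩,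
    g.toWord.getLast hne, by simp [List.getLast?_append, List.getLast?_eq_some_getLast hne],
    hg _ (List.getLast_mem hne)⟩
  rw [hz, List.head?_eq_some_head hne]
  rintro _ ⟨⟩ _ ⟨⟩ h
  exact absurd (h ▸ hg _ (List.head_mem hne)) hz'

theorem IsOuter.invRev (h : IsOuter s L) : IsOuter s (invRev L) := by
  obtain ⟨r, ⟨x, hx, hx'⟩, z, hz, hz'⟩ := h
  refine ⟨r.invRev, ⟨(z.1, !z.2), ?_, hz'⟩, (x.1, !x.2), ?_, hx'⟩
  · simp [FreeGroup.invRev, hz]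
  · simp [FreeGroup.invRev, hx]

theorem exists_mul_outer_mul [DecidableEq α] (s : Set α) (x : FreeGroup α) :
    x ∈ supported s ∨ ∃ p ∈ supported s, ∃ q ∈ supported s, ∃ M, IsOuter s M ∧
      x = p * mk M * q := by
  classical
  set P := x.toWord.takeWhile (fun l => l.1 ∈ s)
  set R := x.toWord.dropWhile (fun l => l.1 ∈ s) with hR
  set M := R.rdropWhile (fun l => l.1 ∈ s) with hM
  set Q := R.rtakeWhile (fun l => l.1 ∈ s)
  have hRMQ : M ++ Q = R := List.rdropWhile_append_rtakeWhile
  have hx : P ++ (M ++ Q) = x.toWord := by rw [hRMQ]; exact List.takeWhile_append_dropWhile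
  have hP : mk P ∈ supported s := mk_mem_supported fun l hl => by
    simpa using List.mem_takeWhile_imp hl
  have hQ : mk Q ∈ supported s := mk_mem_supported fun l hl => by
    simpa using List.mem_rtakeWhile_imp hl
  have hx' : x = mk P * mk M * mk Q := by
    rw [← mk_append, ← mk_append, List.append_assoc, hx, mk_toWord]
  by_cases hM0 : M = []
  · left
    rw [hx', hM0, ← one_eq_mk, mul_one]
    exact mul_mem hP hQ
  · right
    refine ⟨_, hP, _, hQ, M, ⟨?_, ⟨M.head hM0, List.head?_eq_some_head hM0, ?_⟩,
      M.getLast hM0, List.getLast?_eq_some_getLast hM0, ?_⟩, hx'⟩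
    · exact (isReduced_toWord (x := x)).infix ⟨P, Q, by rw [← hx, List.append_assoc]⟩
    · have hR0 : R ≠ [] := by rw [← hRMQ]; simp [hM0]
      have h1 : M.head hM0 = R.head hR0 := by
        simp only [← hRMQ, List.head_append_of_ne_nil hM0]
      rw [h1]
      simpa using List.head_dropWhile_not (p := fun l : α × Bool => decide (l.1 ∈ s)) hR0
    · simpa using List.rdropWhile_last_not (fun l : α × Bool => decide (l.1 ∈ s)) R hM0

section Conj

variable {a b y : α}

theorem isConj_quadWord_of (a b y : α) : IsConj (quadWord (of a) (of b) (of y))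
    (mk [(y, true), (b, true), (y, true), (a, true), (y, false), (b, true), (y, false),
      (a, true)]) :=
  isConj_iff.2 ⟨(of a)⁻¹, by
    rw [(show quadWord (of a) (of b) (of y) = of a * mk [(y, true), (b, true), (y, true),
      (a, true), (y, false), (b, true), (y, false)] by simp [quadWord, of, inv_mk, invRev])]
    rw [inv_mul_cancel_left, inv_inv, of, ← mk_append]
    rfl⟩

theorem isMixed_quadWord (hay : y ≠ a) (hby : y ≠ b) : IsMixed {a, b}
    [(y, true), (b, true), (y, true), (a, true), (y, false), (b, true), (y, false),
      (a, true)] := by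
  refine ⟨?_, ⟨_, rfl, by simp [hay, hby]⟩, (a, true), by simp, by simp⟩
  simp [isReduced_cons_cons, hay, hby, hay.symm, hby.symm]

variable [DecidableEq α]

theorem not_isConj_quadWord_of_mem_supported (hay : y ≠ a) (hby : y ≠ b) {x : FreeGroup α}
    (hx : x ∈ supported {a, b}) :
    ¬ IsConj (quadWord (of a) (of b) x) (quadWord (of a) (of b) (of y)) := by
  intro h
  let r : FreeGroup α →* FreeGroup α := lift fun z => if z = a ∨ z = b then of z else 1
  have hr : ∀ z ∈ supported {a, b}, r z = z := by
    intro z hz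
    rw [supported_eq_closure] at hz
    induction hz using Subgroup.closure_induction with
    | mem z hz =>
      obtain ⟨w, hw, rfl⟩ := hz
      simp only [Set.mem_insert_iff, Set.mem_singleton_iff] at hw
      simp [r, hw]
    | one => simp
    | mul _ _ _ _ h1 h2 => simp [h1, h2]
    | inv _ _ h => simp [h]
  have ha : of a ∈ supported {a, b} := of_mem_supported (by simp)
  have hb : of b ∈ supported {a, b} := of_mem_supported (by simp)
  have h1 := r.map_isConj h
  rw [map_quadWord, map_quadWord, hr _ ha, hr _ hb, hr _ hx] at h1
  have h2 : IsConj (mk [(a, true), (b, true), (a, true), (b, true)])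
      (quadWord (of a) (of b) (r (of y))) := by
    have : r (of y) = 1 := by simp [r, hay, hby]
    rw [this, (show quadWord (of a) (of b) 1 = mk [(a, true), (b, true), (a, true), (b, true)] by
      simp [quadWord, of])]
  have h3 := ((h2.trans h1.symm).trans h).trans (isConj_quadWord_of a b y)
  have h4 := IsCyclicallyReduced.isRotated_of_isConj ?_
    (isMixed_quadWord hay hby).isCyclicallyReduced h3
  · simpa using h4.perm.length_eq
  · simp [IsCyclicallyReduced, isReduced_cons_cons]

theorem not_isConj_quadWord_of_mul_eq_one (hay : y ≠ a) (hby : y ≠ b) {p q : FreeGroup α}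
    (hp : p ∈ supported {a, b}) (hq : q ∈ supported {a, b}) {M : List (α × Bool)}
    (hM : IsOuter {a, b} M) (hqp : q * of b * p = 1) :
    ¬ IsConj (quadWord (of a) (of b) (p * mk M * q)) (quadWord (of a) (of b) (of y)) := by
  intro h
  have ha : of a ∈ supported {a, b} := of_mem_supported (by simp)
  have hb : of b ∈ supported {a, b} := of_mem_supported (by simp)
  set S := reduceCyclically.conjugator M
  set C := reduceCyclically M
  have hSC : S ++ C ++ invRev S = M := reduceCyclically.conj_conjugator_reduceCyclically M
  have hC : IsCyclicallyReduced C := reduceCyclically.isCyclicallyReduced hM.1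
  have hC0 : C ≠ [] := by
    intro hC0
    rw [hC0, List.append_nil] at hSC
    have : M = [] := hM.1.eq_of_mk_eq IsReduced.nil (by
      rw [← hSC, mk_append, ← inv_mk, mul_inv_cancel, one_eq_mk])
    obtain ⟨_, ⟨x, hx, -⟩, -⟩ := hM
    simp [this] at hx
  have hD : IsReduced (S ++ (C ++ C) ++ invRev S) := by
    have := IsReduced.append_flatten_replicate_append hC (hSC ▸ hM.1) (n := 2) (by simp)
    simpa [List.replicate_succ] using this
  have hDM : IsOuter {a, b} (S ++ (C ++ C) ++ invRev S) := by
    obtain ⟨-, ⟨x, hx, hx'⟩, z, hz, hz'⟩ := hM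
    refine ⟨hD, ⟨x, ?_, hx'⟩, z, ?_, hz'⟩
    · rw [← hx, ← hSC]
      simp [List.head?_append, List.head?_eq_some_head hC0]
    · rw [← hz, ← hSC]
      simp [List.getLast?_append, List.getLast?_eq_some_getLast hC0]
  have h2 : q * of a * q⁻¹ ≠ 1 := by simp
  have h3 : p⁻¹ * of b * q⁻¹ ≠ 1 := by
    intro h3
    have e1 : of b = p * q := by
      rw [mul_inv_eq_one, inv_mul_eq_iff_eq_mul] at h3; exact h3
    have e2 : of b = q⁻¹ * p⁻¹ := by
      rw [mul_eq_one_iff_eq_inv, ← eq_inv_mul_iff_mul_eq] at hqp; exact hqp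
    have e3 : (of b) ^ 2 = 1 := by
      rw [pow_two]; nth_rw 1 [e1]; rw [e2]; group
    simpa using congrArg toWord e3
  have h4 : p⁻¹ * of a * p ≠ 1 := by
    simpa using conj_eq_one_iff (a := p⁻¹) (b := of a) |>.not.2 (by simp)
  have hW := (hDM.isMixed_append_toWord (mul_mem (mul_mem hq ha) (inv_mem hq)) h2).append
    ((hM.invRev.isMixed_append_toWord (mul_mem (mul_mem (inv_mem hp) hb) (inv_mem hq)) h3).append
    (hM.invRev.isMixed_append_toWord (mul_mem (mul_mem (inv_mem hp) ha) hp) h4))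
  have hWc : IsConj (quadWord (of a) (of b) (p * mk M * q))
      (mk (S ++ (C ++ C) ++ invRev S ++ (q * of a * q⁻¹).toWord ++
        (invRev M ++ (p⁻¹ * of b * q⁻¹).toWord ++ (invRev M ++ (p⁻¹ * of a * p).toWord)))) := by
    have hDm : mk (S ++ (C ++ C) ++ invRev S) = mk M * mk M := by
      rw [← hSC]; simp only [mk_append, ← inv_mk]; group
    have : quadWord (of a) (of b) (p * mk M * q) = of a * p * mk M * (q * of b * p) * mk M *
        q * of a * (p * mk M * q)⁻¹ * of b * (p * mk M * q)⁻¹ := by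
      simp only [quadWord]; group
    refine isConj_iff.2 ⟨(of a * p)⁻¹, ?_⟩
    rw [this, hqp, mk_append, mk_append (S ++ (C ++ C) ++ invRev S), hDm]
    simp only [mk_append, mk_toWord, ← inv_mk]
    group
  have hrot := IsCyclicallyReduced.isRotated_of_isConj
    (isMixed_quadWord hay hby).isCyclicallyReduced hW.isCyclicallyReduced
    (((isConj_quadWord_of a b y).symm.trans h.symm).trans hWc)
  have hlen := hrot.perm.length_eq
  have hlM := congrArg List.length hSC
  have l2 := List.length_pos_iff.2 (toWord_eq_nil_iff.not.2 h2)
  have l3 := List.length_pos_iff.2 (toWord_eq_nil_iff.not.2 h3)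
  have l4 := List.length_pos_iff.2 (toWord_eq_nil_iff.not.2 h4)
  have l5 := List.length_pos_iff.2 hC0
  simp only [List.length_append, invRev_length, List.length_cons, List.length_nil] at hlen hlM
  have hS : S = [] := List.length_eq_zero_iff.1 (by omega)
  obtain ⟨c, hc⟩ := List.length_eq_one_iff.1 (show C.length = 1 by omega)
  rw [hS, hc] at hrot
  obtain ⟨n, hn, hrot⟩ := List.isRotated_iff_mod.1 hrot
  simp only [List.length_cons, List.length_nil] at hn
  interval_cases n <;> simp [List.rotate_cons_succ] at hrot <;>
    obtain ⟨rfl, h1, -⟩ := hrot <;> simp [hay, hby, hay.symm, hby.symm] at h1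

end Conj

/-- An element commuting with an element that is not a proper power is a power of it. -/
theorem mem_zpowers_of_commute {w h : FreeGroup α} (hw : ∀ c (n : ℤ), w = c ^ n → n = 1 ∨ n = -1)
    (hc : Commute w h) : h ∈ Subgroup.zpowers w := by
  let K := Subgroup.closure {w, h}
  have hcomm : ∀ x y : K, x * y = y * x := by
    have := Subgroup.isMulCommutative_closure (k := {w, h}) (by
      rintro x (rfl | rfl) y (rfl | rfl)
      exacts [rfl, hc, hc.symm, rfl])
    exact fun x y => this.is_comm.comm x y
  obtain ⟨ι, ⟨B⟩⟩ := IsFreeGroup.nonempty_basis (G := K)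
  have hι : Subsingleton ι := ⟨fun i j => by
    by_contra hij
    classical
    have := congrArg B.repr (hcomm (B i) (B j))
    simp only [_root_.map_mul, FreeGroupBasis.repr_apply_coe] at this
    have := congrArg toWord this
    simp [toWord_mul, reduce.cons, hij] at this⟩
  obtain ⟨c, hcK⟩ : ∃ c : K, ∀ x : K, ∃ n : ℤ, x = c ^ n := by
    rcases isEmpty_or_nonempty ι with hι' | ⟨⟨i⟩⟩
    · exact ⟨1, fun x => ⟨0, B.repr.injective (Subsingleton.elim _ _)⟩⟩
    · refine ⟨B i, fun x => ?_⟩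
      have hx : B.repr x ∈ Subgroup.zpowers (of i) := by
        induction B.repr x using FreeGroup.induction_on with
        | C1 => exact one_mem _
        | of j => rw [Subsingleton.elim j i]; exact Subgroup.mem_zpowers _
        | inv_of j h => exact inv_mem h
        | mul x y hx hy => exact mul_mem hx hy
      obtain ⟨n, hn⟩ := hx
      exact ⟨n, B.repr.injective (by simp [← hn])⟩
  obtain ⟨n, hn⟩ := hcK ⟨w, Subgroup.subset_closure (by simp)⟩
  obtain ⟨m, hm⟩ := hcK ⟨h, Subgroup.subset_closure (by simp)⟩
  have hwc : w = (c : FreeGroup α) ^ n := by simpa using congrArg Subtype.val hn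
  have hhc : h = (c : FreeGroup α) ^ m := by simpa using congrArg Subtype.val hm
  rcases hw _ _ hwc with rfl | rfl
  · exact ⟨m, by simp [hwc, hhc]⟩
  · exact ⟨-m, by simp [hwc, hhc]⟩

/-- The exponent sum of the letter `x`. -/
def exponentSum [DecidableEq α] (x : α) : FreeGroup α →* Multiplicative ℤ :=
  lift fun z => if z = x then Multiplicative.ofAdd 1 else 1

@[simp]
theorem exponentSum_of [DecidableEq α] (x z : α) :
    exponentSum x (of z) = if z = x then Multiplicative.ofAdd 1 else 1 := by
  simp [exponentSum]

theorem of_eq_zpow {x : α} {c : FreeGroup α} {n : ℤ} (h : of x = c ^ n) : n = 1 ∨ n = -1 := by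
  classical
  have := congrArg (fun g => Multiplicative.toAdd (exponentSum x g)) h
  simp at this
  exact Int.isUnit_iff.1 (IsUnit.of_mul_eq_one _ this.symm)

/-- The only solutions `x` of the equation saying that `a x b x a x⁻¹ b x⁻¹` is conjugate to
`a y b y a y⁻¹ b y⁻¹` in a free group with distinct basis elements `a`, `b`, `y` are
`y` and `y⁻¹`. -/
theorem eq_of_isConj_quadWord {a b y : α} (hab : a ≠ b) (hay : y ≠ a) (hby : y ≠ b)
    {x : FreeGroup α} (h : IsConj (quadWord (of a) (of b) x) (quadWord (of a) (of b) (of y))) :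
    x = of y ∨ x = (of y)⁻¹ := by
  classical
  obtain hx | ⟨p, hp, q, hq, M, hM, rfl⟩ := exists_mul_outer_mul {a, b} x
  · exact absurd h (not_isConj_quadWord_of_mem_supported hay hby hx)
  have ha : of a ∈ supported {a, b} := of_mem_supported (by simp)
  have hb : of b ∈ supported {a, b} := of_mem_supported (by simp)
  have h1 : q * of b * p ≠ 1 := fun h1 => not_isConj_quadWord_of_mul_eq_one hay hby hp hq hM h1 h
  have h2 : q * of a * q⁻¹ ≠ 1 := by simp
  have h3 : p⁻¹ * of b * q⁻¹ ≠ 1 := fun h3 => by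
    refine not_isConj_quadWord_of_mul_eq_one hay hby (inv_mem hq) (inv_mem hp) hM.invRev h3 ?_
    rw [← inv_mk, show q⁻¹ * (mk M)⁻¹ * p⁻¹ = (p * mk M * q)⁻¹ by group]
    exact (isConj_quadWord_inv _ _ _).trans h
  have h4 : p⁻¹ * of a * p ≠ 1 := by
    simpa using conj_eq_one_iff (a := p⁻¹) (b := of a) |>.not.2 (by simp)
  have hW := ((hM.isMixed_append_toWord (mul_mem (mul_mem hq hb) hp) h1).append
    (hM.isMixed_append_toWord (mul_mem (mul_mem hq ha) (inv_mem hq)) h2)).append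
    ((hM.invRev.isMixed_append_toWord (mul_mem (mul_mem (inv_mem hp) hb) (inv_mem hq)) h3).append
    (hM.invRev.isMixed_append_toWord (mul_mem (mul_mem (inv_mem hp) ha) hp) h4))
  have hWc : IsConj (quadWord (of a) (of b) (p * mk M * q))
      (mk ((M ++ (q * of b * p).toWord ++ (M ++ (q * of a * q⁻¹).toWord)) ++
        (invRev M ++ (p⁻¹ * of b * q⁻¹).toWord ++ (invRev M ++ (p⁻¹ * of a * p).toWord)))) := by
    refine isConj_iff.2 ⟨(of a * p)⁻¹, ?_⟩
    simp only [mk_append, mk_toWord, ← inv_mk, quadWord]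
    group
  have hrot := IsCyclicallyReduced.isRotated_of_isConj
    (isMixed_quadWord hay hby).isCyclicallyReduced hW.isCyclicallyReduced
    (((isConj_quadWord_of a b y).symm.trans h.symm).trans hWc)
  have hlen := hrot.perm.length_eq
  have l1 := List.length_pos_iff.2 (toWord_eq_nil_iff.not.2 h1)
  have l2 := List.length_pos_iff.2 (toWord_eq_nil_iff.not.2 h2)
  have l3 := List.length_pos_iff.2 (toWord_eq_nil_iff.not.2 h3)
  have l4 := List.length_pos_iff.2 (toWord_eq_nil_iff.not.2 h4)
  simp only [List.length_append, invRev_length, List.length_cons, List.length_nil] at hlen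
  have l5 : 0 < M.length := by
    obtain ⟨-, ⟨x, hx, -⟩, -⟩ := hM
    exact List.length_pos_iff.2 fun h => by simp [h] at hx
  obtain ⟨m, rfl⟩ := List.length_eq_one_iff.1 (show M.length = 1 by omega)
  obtain ⟨c1, hc1⟩ := List.length_eq_one_iff.1 (show (q * of b * p).toWord.length = 1 by omega)
  obtain ⟨c2, hc2⟩ := List.length_eq_one_iff.1 (show (q * of a * q⁻¹).toWord.length = 1 by omega)
  obtain ⟨c3, hc3⟩ := List.length_eq_one_iff.1
    (show (p⁻¹ * of b * q⁻¹).toWord.length = 1 by omega)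
  obtain ⟨c4, hc4⟩ := List.length_eq_one_iff.1 (show (p⁻¹ * of a * p).toWord.length = 1 by omega)
  rw [hc1, hc2, hc3, hc4] at hrot
  obtain ⟨n, hn, hrot⟩ := List.isRotated_iff_mod.1 hrot
  simp only [List.length_cons, List.length_nil] at hn
  have key : (m = (y, true) ∨ m = (y, false)) ∧ c1 = (b, true) ∧ c2 = (a, true) ∧
      c4 = (a, true) := by
    interval_cases n <;> simp [List.rotate_cons_succ, invRev] at hrot <;> grind
  obtain ⟨hm, rfl, rfl, rfl⟩ := key
  have e1 : q * of b * p = of b := toWord_injective (by simpa using hc1)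
  have e2 : q * of a * q⁻¹ = of a := toWord_injective (by simpa using hc2)
  have e4 : p⁻¹ * of a * p = of a := toWord_injective (by simpa using hc4)
  have hpa : p ∈ Subgroup.zpowers (of a) :=
    mem_zpowers_of_commute (fun _ _ => of_eq_zpow) (by
      rw [mul_assoc, inv_mul_eq_iff_eq_mul] at e4; exact e4)
  have hqa : q ∈ Subgroup.zpowers (of a) :=
    mem_zpowers_of_commute (fun _ _ => of_eq_zpow) (by
      rw [mul_inv_eq_iff_eq_mul] at e2; exact e2.symm)
  obtain ⟨i, rfl⟩ := hpa
  obtain ⟨j, rfl⟩ := hqa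
  have hij : j = -i := by
    have := congrArg (fun g => Multiplicative.toAdd (exponentSum a g)) e1
    simp [hab.symm] at this
    omega
  have hpb : of a ^ i ∈ Subgroup.zpowers (of b) :=
    mem_zpowers_of_commute (fun _ _ => of_eq_zpow) (by
      simp only [hij, zpow_neg, mul_assoc] at e1
      rw [inv_mul_eq_iff_eq_mul] at e1; exact e1)
  obtain ⟨k, hk⟩ := hpb
  have hi : i = 0 := by
    have := congrArg (fun g => Multiplicative.toAdd (exponentSum a g)) hk
    simpa [hab.symm] using this.symm
  subst hi
  simp only [hij, neg_zero, zpow_zero, one_mul, mul_one]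
  rcases hm with rfl | rfl
  · exact Or.inl rfl
  · exact Or.inr (by simp [of, inv_mk, invRev])

end FreeGroup

namespace HNNExtension

variable {G : Type*} [Group G] {A B : Subgroup G} {φ : A ≃* B}

/-- The endomorphism of an HNN extension that is the identity on the base group and multiplies the
stable letter on the right by a central element `c` of the first associated subgroup. -/
def shift (φ : A ≃* B) (c : A) (hc : ∀ x, c * x = x * c) :
    HNNExtension G A B φ →* HNNExtension G A B φ :=
  lift of (t * of (c : G)) fun x => by
    rw [mul_assoc, ← map_mul, ← Subgroup.coe_mul, hc, Subgroup.coe_mul, map_mul, ← mul_assoc,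
      t_mul_of, mul_assoc]

/-- The element by which `shift` multiplies the base group element after a letter `t ^ e`. -/
def shiftFactor (φ : A ≃* B) (c : A) (e : ℤˣ) : G :=
  if e = 1 then c else (φ c : G)⁻¹

theorem shiftFactor_mem (c : A) (e : ℤˣ) : shiftFactor φ c e ∈ toSubgroup A B e := by
  rcases Int.units_eq_one_or e with rfl | rfl <;> simp [shiftFactor]

@[simp]
theorem shift_of (c : A) (hc : ∀ x, c * x = x * c) (g : G) : shift φ c hc (of g) = of g := by
  simp [shift]

@[simp]
theorem shift_t (c : A) (hc : ∀ x, c * x = x * c) : shift φ c hc t = t * of (c : G) := by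
  simp [shift]

theorem shift_letter (c : A) (hc : ∀ x, c * x = x * c) (e : ℤˣ) (g : G) :
    shift φ c hc (t ^ (e : ℤ) * of g) = t ^ (e : ℤ) * of (shiftFactor φ c e * g) := by
  rcases Int.units_eq_one_or e with rfl | rfl
  · simp [shiftFactor, mul_assoc]
  · have := of_mul_inv_t (φ := φ) c⁻¹
    simp only [map_inv, Subgroup.coe_inv] at this
    simp [shiftFactor, ← mul_assoc, this]

open NormalWord

theorem eq_of_shift_eq {c : A} {hc : ∀ x, c * x = x * c}
    (h₁ : ∀ e g, g⁻¹ * shiftFactor φ c e * g ∉ toSubgroup A B (-e))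
    (h₂ : ∀ e g, g⁻¹ * shiftFactor φ c e * g ∈ toSubgroup A B e → g ∈ toSubgroup A B e)
    {f : HNNExtension G A B φ} (hf : shift φ c hc f = f) : f ∈ (of (φ := φ)).range := by
  obtain ⟨d⟩ := TransversalPair.nonempty G A B
  obtain ⟨w, rfl⟩ := (equiv φ d).symm.surjective f
  obtain ⟨⟨g₀, l, hl⟩, hd⟩ := w
  change shift φ c hc (ReducedWord.prod φ ⟨g₀, l, hl⟩) = ReducedWord.prod φ ⟨g₀, l, hl⟩ at hf
  change ReducedWord.prod φ ⟨g₀, l, hl⟩ ∈ _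
  clear hd
  match l, hl, hf with
  | [], _, _ => exact ⟨g₀, by simp [ReducedWord.prod]⟩
  | (e, g) :: l, hl, hf =>
    exfalso
    let σ : ℤˣ × G → ℤˣ × G := fun x => (x.1, shiftFactor φ c x.1 * x.2)
    have hσl : (l.map σ).IsChain fun a b => a.2 ∈ toSubgroup A B a.1 → a.1 = b.1 := by
      rw [List.isChain_map]
      refine (List.isChain_cons.1 hl).2.imp fun x y h hx => h ?_
      exact (Subgroup.mul_mem_cancel_left _ (shiftFactor_mem c x.1)).1 hx
    have hσ : shift φ c hc (l.map fun x => t ^ (x.1 : ℤ) * of x.2).prod =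
        ((l.map σ).map fun x => t ^ (x.1 : ℤ) * of x.2).prod := by
      rw [map_list_prod, List.map_map, List.map_map]
      congr 2
      funext x
      exact shift_letter c hc x.1 x.2
    have hprod : ReducedWord.prod φ ⟨shiftFactor φ c e * g, l.map σ, hσl⟩ =
        ReducedWord.prod φ ⟨g, l, (List.isChain_cons.1 hl).2⟩ := by
      simp only [ReducedWord.prod, List.map_cons, List.prod_cons] at hf ⊢
      rw [map_mul, map_mul, shift_of, shift_letter, hσ] at hf
      simpa [mul_assoc] using hf
    have hkey := (ReducedWord.map_fst_eq_and_of_prod_eq φ hprod).2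
    simp only [mul_inv_rev, List.head?_map] at hkey
    have hinv : g⁻¹ * (shiftFactor φ c e)⁻¹ * g = (g⁻¹ * shiftFactor φ c e * g)⁻¹ := by group
    obtain _ | ⟨⟨e', g'⟩, l⟩ := l
    · apply h₁ e 1
      have := of_injective (φ := φ) (by simpa [ReducedWord.prod] using hprod :
        of (shiftFactor φ c e) = (of 1 : HNNExtension G A B φ))
      simp [this, one_mem]
    · have hkey := hkey e' (by simp [σ])
      rw [hinv, inv_mem_iff] at hkey
      rcases eq_or_ne e' e with rfl | he
      · exact h₁ _ _ hkey
      · obtain rfl : e' = -e := Int.units_ne_iff_eq_neg.1 he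
        rw [neg_neg] at hkey
        have := (List.isChain_cons_cons.1 hl).1 (h₂ _ _ hkey)
        exact absurd this (by simp)

end HNNExtension

namespace FreeGroup

variable {α : Type*}

theorem conj_zpow_notMem_zpowers {G : Type*} [Group G] {χ : G →* Multiplicative ℤ} {w w' : G}
    (h : χ w ≠ 1) (h' : χ w' = 1) {m : ℤ} (hm : m ≠ 0) (g : G) :
    g⁻¹ * w ^ m * g ∉ Subgroup.zpowers w' := by
  rintro ⟨k, hk⟩
  have := congrArg χ hk
  simp only [map_zpow, _root_.map_mul, _root_.map_inv, h', one_zpow] at this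
  rw [mul_right_comm, inv_mul_cancel, one_mul] at this
  exact h ((IsMulTorsionFree.zpow_eq_one_iff_left hm).1 this.symm)

theorem mem_zpowers_of_conj_zpow_mem {χ : FreeGroup α →* Multiplicative ℤ} {w : FreeGroup α}
    (h : χ w ≠ 1) (hw : ∀ c (n : ℤ), w = c ^ n → n = 1 ∨ n = -1) {m : ℤ} (hm : m ≠ 0)
    {g : FreeGroup α} (hg : g⁻¹ * w ^ m * g ∈ Subgroup.zpowers w) : g ∈ Subgroup.zpowers w := by
  obtain ⟨k, hk⟩ := hg
  have hkm : k = m := by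
    have := congrArg χ hk
    simp only [map_zpow, _root_.map_mul, _root_.map_inv] at this
    rw [mul_right_comm, inv_mul_cancel, one_mul] at this
    rw [← mul_inv_eq_one, ← zpow_neg, ← zpow_add, IsMulTorsionFree.zpow_eq_one_iff_right h] at this
    omega
  subst hkm
  refine mem_zpowers_of_commute hw ?_
  have h1 : (g⁻¹ * w * g) ^ k = w ^ k := by
    refine .trans ?_ hk.symm
    simpa using conj_zpow (a := g⁻¹) (b := w) (i := k)
  have h2 := zpow_left_injective hm h1
  rw [mul_assoc, inv_mul_eq_iff_eq_mul] at h2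
  exact h2

end FreeGroup

namespace HNNCounterexample

variable (A₀ : Type)

theorem v_eq_quadWord : v A₀ = quadWord (a A₀) (b A₀) (y A₀) := rfl

open FreeGroup in
theorem v_eq_zpow {c : Base A₀} {n : ℤ} (h : v A₀ = c ^ n) : n = 1 ∨ n = -1 := by
  classical
  let g : Fin 4 → Equiv.Perm (Fin 4) := ![c[1, 2, 3], c[1, 3, 2], 1, (c[0, 1, 2])]
  let ρ : Base A₀ →* Equiv.Perm (Fin 4) := FreeGroup.lift (Sum.elim 1 g)
  have hs : ∀ x, Equiv.Perm.sign (ρ x) = 1 := by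
    have : Equiv.Perm.sign.comp ρ = 1 := by
      ext i
      rcases i with i | i
      · simp [ρ]
      · fin_cases i <;> simp [ρ, g] <;> decide
    exact fun x => DFunLike.congr_fun this x
  have hv : ρ (v A₀) = c[0, 1] * c[2, 3] := by
    simp [ρ, g, v, a, b, y]
    decide
  have key : ∀ p : Equiv.Perm (Fin 4), Equiv.Perm.sign p = 1 → p ^ 2 ≠ c[0, 1] * c[2, 3] := by
    decide
  have hn := congrArg (fun x => Multiplicative.toAdd (exponentSum (Sum.inr 0) x)) h
  simp [v, a, b, y] at hn
  have hn' : n ∣ 2 := ⟨_, hn⟩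
  have hle : n ≤ 2 := Int.le_of_dvd two_pos hn'
  have hge : -n ≤ 2 := Int.le_of_dvd two_pos (Int.neg_dvd.2 hn')
  have hsq (p : Base A₀) : v A₀ ≠ p ^ 2 := fun hp => key (ρ p) (hs p) (by
    rw [← hv, hp, _root_.map_pow])
  rcases (by omega : n = -2 ∨ n = -1 ∨ n = 0 ∨ n = 1 ∨ n = 2) with rfl | rfl | rfl | rfl | rfl
  · exact absurd (by rw [h, zpow_neg, inv_pow]; rfl) (hsq c⁻¹)
  · exact Or.inr rfl
  · simp at hn
  · exact Or.inl rfl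
  · exact absurd h (hsq c)

open FreeGroup HNNExtension in
theorem mem_range_of_shift_eq
    (φ : ↥(Subgroup.zpowers (u A₀)) ≃* ↥(Subgroup.zpowers (v A₀)))
    (hφ : φ ⟨u A₀, Subgroup.mem_zpowers (u A₀)⟩ = ⟨v A₀, Subgroup.mem_zpowers (v A₀)⟩)
    {m : ℤ} (hm : m ≠ 0) (hc) {f : Ext A₀ φ}
    (hf : shift φ (⟨u A₀, Subgroup.mem_zpowers (u A₀)⟩ ^ m) hc f = f) :
    f ∈ (ofH A₀ φ).range := by
  classical
  have hm' : -m ≠ 0 := neg_ne_zero.2 hm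
  have hfac : shiftFactor φ (⟨u A₀, Subgroup.mem_zpowers (u A₀)⟩ ^ m) 1 = u A₀ ^ m := by
    simp [shiftFactor]
  have hfac' : shiftFactor φ (⟨u A₀, Subgroup.mem_zpowers (u A₀)⟩ ^ m) (-1) = v A₀ ^ (-m) := by
    simp [shiftFactor, hφ]
  have h1 : exponentSum (Sum.inr 2) (u A₀) ≠ 1 := by simp [u]
  have h2 : exponentSum (Sum.inr 2) (v A₀) = 1 := by simp [v, a, b, y]
  have h3 : exponentSum (Sum.inr 0) (u A₀) = 1 := by simp [u]
  have h4 : exponentSum (Sum.inr 0) (v A₀) ≠ 1 := by simp [v, a, b, y]; decide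
  refine eq_of_shift_eq (fun e g => ?_) (fun e g => ?_) hf <;>
    rcases Int.units_eq_one_or e with rfl | rfl
  · rw [hfac]
    exact conj_zpow_notMem_zpowers h1 h2 hm g
  · rw [hfac']
    exact conj_zpow_notMem_zpowers h4 h3 hm' g
  · rw [hfac]
    exact mem_zpowers_of_conj_zpow_mem h1 (fun _ _ => of_eq_zpow) hm
  · rw [hfac']
    exact mem_zpowers_of_conj_zpow_mem h4 (fun _ _ => v_eq_zpow A₀) hm'

end HNNCounterexample

section ModelTheory

variable {L : FirstOrder.Language} {M : Type*} [L.Structure M] {A : Set M}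

theorem LaclE_subset_Lacl : LaclE L A ⊆ Lacl L A :=
  fun _ ⟨ψ, _, h⟩ => ⟨ψ, h⟩

theorem LdclE_subset_Ldcl : LdclE L A ⊆ Ldcl L A :=
  fun _ ⟨ψ, _, h⟩ => ⟨ψ, h⟩

theorem Ldcl_subset_Lacl : Ldcl L A ⊆ Lacl L A := fun x ⟨ψ, h⟩ =>
  ⟨ψ, by rw [h]; exact Set.finite_singleton x, by
    change x ∈ {c : M | ψ.Realize (Sum.elim Subtype.val fun _ => c)}
    rw [h]; rfl⟩

theorem realize_apply_equiv (σ : M ≃[L] M) (hσ : ∀ c ∈ A, σ c = c) (ψ : L.Formula (↥A ⊕ Fin 1))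
    (c : M) : ψ.Realize (Sum.elim Subtype.val fun _ => σ c) ↔
      ψ.Realize (Sum.elim Subtype.val fun _ => c) := by
  rw [← FirstOrder.Language.StrongHomClass.realize_formula σ ψ
    (v := Sum.elim Subtype.val fun _ => c)]
  refine iff_of_eq (congrArg _ (funext fun i => ?_))
  rcases i with i | i
  · exact (hσ i i.2).symm
  · rfl

end ModelTheory

section GroupLanguage

variable {G : Type*} [Group G] {A : Set G}

/-- A group automorphism as an automorphism of structures in the language of groups. -/
def grpEquiv (σ : G ≃* G) : G ≃[grpLang] G where
  toEquiv := σ.toEquiv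
  map_fun' f x := by
    cases f
    · exact map_one σ
    · exact map_inv σ _
    · exact map_mul σ _ _
  map_rel' r _ := r.elim

theorem acl_subset_racl : acl A ⊆ racl A := by
  rintro g ⟨ψ, hfin, hg⟩
  refine hfin.subset ?_
  rintro _ ⟨σ, hσ, rfl⟩
  exact (realize_apply_equiv (grpEquiv σ) hσ ψ g).2 hg

theorem dcl_subset_rdcl : dcl A ⊆ rdcl A := by
  rintro g ⟨ψ, hψ⟩ σ hσ
  have hg : g ∈ {c : G | ψ.Realize (Sum.elim Subtype.val fun _ => c)} := hψ ▸ rfl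
  have : σ g ∈ {c : G | ψ.Realize (Sum.elim Subtype.val fun _ => c)} :=
    (realize_apply_equiv (grpEquiv σ) hσ ψ g).2 hg
  rwa [hψ] at this

theorem exists_term_realize_eq {β : Type*} (w : FreeGroup β) :
    ∃ τ : grpLang.Term β, ∀ f : β → G, τ.realize f = FreeGroup.lift f w := by
  induction w using FreeGroup.induction_on with
  | C1 => exact ⟨.func GrpFunc.one ![], fun f => (map_one _).symm⟩
  | of x => exact ⟨.var x, fun f => (FreeGroup.lift_apply_of ..).symm⟩
  | inv_of x ih =>
    obtain ⟨τ, hτ⟩ := ih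
    exact ⟨.func GrpFunc.inv ![τ], fun f => by rw [map_inv, ← hτ]; rfl⟩
  | mul x y hx hy =>
    obtain ⟨τ₁, h₁⟩ := hx
    obtain ⟨τ₂, h₂⟩ := hy
    exact ⟨.func GrpFunc.mul ![τ₁, τ₂], fun f => by rw [map_mul, ← h₁, ← h₂]; rfl⟩

/-- A system of two equations in the variables `Fin n` with parameters in `A` and a free variable
is expressed by an existential formula. -/
theorem exists_isExistential_realize_iff {n : ℕ} (w₁ w₂ : FreeGroup ((↥A ⊕ Fin 1) ⊕ Fin n)) :
    ∃ ψ : grpLang.Formula (↥A ⊕ Fin 1), IsExistential ψ ∧ ∀ c : G,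
      ψ.Realize (Sum.elim Subtype.val fun _ => c) ↔ ∃ xs : Fin n → G,
        FreeGroup.lift (Sum.elim (Sum.elim Subtype.val fun _ => c) xs) w₁ = 1 ∧
        FreeGroup.lift (Sum.elim (Sum.elim Subtype.val fun _ => c) xs) w₂ = 1 := by
  obtain ⟨τ₁, h₁⟩ := exists_term_realize_eq (G := G) w₁
  obtain ⟨τ₂, h₂⟩ := exists_term_realize_eq (G := G) w₂
  obtain ⟨τ, hτ⟩ := exists_term_realize_eq (G := G) (1 : FreeGroup ((↥A ⊕ Fin 1) ⊕ Fin n))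
  refine ⟨(τ₁.bdEqual τ ⊓ τ₂.bdEqual τ).exs, ⟨n, _, ?_, rfl⟩, fun c => ?_⟩
  · exact (FirstOrder.Language.BoundedFormula.IsAtomic.equal _ _).isQF.inf
      (FirstOrder.Language.BoundedFormula.IsAtomic.equal _ _).isQF
  · simp [h₁, h₂, hτ]

theorem subset_dclE : A ⊆ dclE A := fun g hg => by
  obtain ⟨ψ, hψ, h⟩ := exists_isExistential_realize_iff (A := A) (n := 0)
    (FreeGroup.of (.inl (.inr 0)) * (FreeGroup.of (.inl (.inl ⟨g, hg⟩)))⁻¹) 1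
  refine ⟨ψ, hψ, Set.ext fun c => ?_⟩
  simp [h, mul_inv_eq_one]

end GroupLanguage

namespace FreeGroup

variable {α : Type*} [DecidableEq α]

/-- The endomorphism of a free group inverting the generator `y` and fixing the others. -/
def flip (y : α) : FreeGroup α →* FreeGroup α :=
  lift fun x => if x = y then (of y)⁻¹ else of x

theorem flip_flip (y : α) (g : FreeGroup α) : flip y (flip y g) = g := by
  have : (flip y).comp (flip y) = MonoidHom.id _ := by
    ext x
    by_cases h : x = y <;> simp [flip, h]
  exact DFunLike.congr_fun this g

theorem flip_mk (y : α) (L : List (α × Bool)) :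
    flip y (mk L) = mk (L.map fun l => (l.1, if l.1 = y then !l.2 else l.2)) := by
  induction L with
  | nil => simp [← one_eq_mk]
  | cons l L ih =>
    rw [mk_cons, _root_.map_mul, ih, List.map_cons, mk_cons (_, _)]
    obtain ⟨x, s⟩ := l
    by_cases h : x = y <;> cases s <;> simp [flip, h, of, inv_mk, invRev]

theorem mem_supported_of_flip_eq {y : α} {g : FreeGroup α} (h : flip y g = g) :
    g ∈ supported {x | x ≠ y} := by
  set σ : α × Bool → α × Bool := fun l => (l.1, if l.1 = y then !l.2 else l.2) with hσ
  have hred : IsReduced (g.toWord.map σ) := by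
    rw [IsReduced, List.isChain_map]
    refine isReduced_toWord.imp fun l l' hl h => ?_
    have h' : l.1 = l'.1 := h
    simp [σ, hl h', h']
  have hmap : g.toWord.map σ = g.toWord := hred.eq_of_mk_eq isReduced_toWord (by
    rw [← flip_mk, mk_toWord, h])
  intro l hl hly
  have := List.map_eq_map_iff.1 (hmap.trans (List.map_id _).symm) l hl
  have := congrArg Prod.snd this
  simp [σ, hly] at this

end FreeGroup

namespace HNNExtension

variable {G : Type*} [Group G] {A B : Subgroup G} {φ : A ≃* B}

theorem shift_shift (c d : A) (hc : ∀ x, c * x = x * c) (hd : ∀ x, d * x = x * d)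
    (hcd : ∀ x, c * d * x = x * (c * d)) (f : HNNExtension G A B φ) :
    shift φ c hc (shift φ d hd f) = shift φ (c * d) hcd f := by
  have : (shift φ c hc).comp (shift φ d hd) = shift φ (c * d) hcd := by
    ext
    · simp
    · simp [mul_assoc]
  exact DFunLike.congr_fun this f

theorem shift_one (h) (f : HNNExtension G A B φ) : shift φ 1 h f = f := by
  have : shift φ 1 h = MonoidHom.id _ := by
    ext <;> simp
  exact DFunLike.congr_fun this f

theorem shift_bijective (c : A) (hc : ∀ x, c * x = x * c) :
    Function.Bijective (shift φ c hc) := by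
  have hc' : ∀ x, c⁻¹ * x = x * c⁻¹ := fun x => (Commute.inv_left (hc x)).eq
  refine Function.bijective_iff_has_inverse.2 ⟨shift φ c⁻¹ hc', fun f => ?_, fun f => ?_⟩
  · rw [shift_shift _ _ _ _ (by simp)]
    simp only [inv_mul_cancel, shift_one]
  · rw [shift_shift _ _ _ _ (by simp)]
    simp only [mul_inv_cancel, shift_one]

theorem mul_eq_mul_of_mem_zpowers {G H : Type*} [Group G] [Group H] {u v : G}
    {φ : Subgroup.zpowers u ≃* Subgroup.zpowers v}
    (hφ : φ ⟨u, Subgroup.mem_zpowers u⟩ = ⟨v, Subgroup.mem_zpowers v⟩) {f : G →* H} {x : H}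
    (hx : x * f u = f v * x) (c : Subgroup.zpowers u) : x * f c = f (φ c) * x := by
  obtain ⟨_, n, rfl⟩ := c
  have h1 : (⟨u ^ n, n, rfl⟩ : Subgroup.zpowers u) = ⟨u, Subgroup.mem_zpowers u⟩ ^ n := rfl
  have h2 : SemiconjBy x (f u) (f v) := hx
  change x * f (u ^ n) = _
  rw [h1, map_zpow f, map_zpow φ, hφ, Subgroup.coe_zpow, map_zpow f]
  exact h2.zpow_right n

end HNNExtension

namespace HNNCounterexample

open HNNExtension

variable {A₀ : Type} {φ : ↥(Subgroup.zpowers (u A₀)) ≃* ↥(Subgroup.zpowers (v A₀))}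

theorem base_hom_ext {H : Type*} [Monoid H] {f g : Base A₀ →* H}
    (h : ∀ i, f (FreeGroup.of (Sum.inl i)) = g (FreeGroup.of (Sum.inl i)))
    (ha : f (a A₀) = g (a A₀)) (hb : f (b A₀) = g (b A₀)) (hu : f (u A₀) = g (u A₀))
    (hy : f (y A₀) = g (y A₀)) : f = g := by
  ext i
  rcases i with i | i
  · exact h i
  · fin_cases i
    exacts [ha, hb, hu, hy]

/-- The homomorphism from `H` with prescribed images of the generators. -/
def baseLift {H : Type*} [Group H] (f : A₀ → H) (a' b' u' y' : H) : Base A₀ →* H :=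
  FreeGroup.lift (Sum.elim f ![a', b', u', y'])

section baseLift

variable {H : Type*} [Group H] (f : A₀ → H) (a' b' u' y' : H)

@[simp]
theorem baseLift_inl (i : A₀) : baseLift f a' b' u' y' (FreeGroup.of (Sum.inl i)) = f i := by
  simp [baseLift]

@[simp]
theorem baseLift_a : baseLift f a' b' u' y' (a A₀) = a' := by simp [baseLift, a]

@[simp]
theorem baseLift_b : baseLift f a' b' u' y' (b A₀) = b' := by simp [baseLift, b]

@[simp]
theorem baseLift_u : baseLift f a' b' u' y' (u A₀) = u' := by simp [baseLift, u]

@[simp]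
theorem baseLift_y : baseLift f a' b' u' y' (y A₀) = y' := by simp [baseLift, y]

@[simp]
theorem baseLift_v : baseLift f a' b' u' y' (v A₀) = quadWord a' b' y' := by
  rw [v_eq_quadWord, map_quadWord, baseLift_a, baseLift_b, baseLift_y]

theorem map_baseLift {H' : Type*} [Group H'] (k : H →* H') (h : Base A₀) :
    k (baseLift f a' b' u' y' h) = baseLift (fun i => k (f i)) (k a') (k b') (k u') (k y') h := by
  have : k.comp (baseLift f a' b' u' y') =
      baseLift (fun i => k (f i)) (k a') (k b') (k u') (k y') := by
    apply base_hom_ext <;> simp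
  exact DFunLike.congr_fun this h

end baseLift

theorem t_mul_u (hφ : φ ⟨u A₀, Subgroup.mem_zpowers (u A₀)⟩ = ⟨v A₀, Subgroup.mem_zpowers (v A₀)⟩) :
    (t : Ext A₀ φ) * ofH A₀ φ (u A₀) = ofH A₀ φ (v A₀) * t := by
  have := t_mul_of (φ := φ) ⟨u A₀, Subgroup.mem_zpowers (u A₀)⟩
  rwa [hφ] at this

/-- The homomorphism from the extension to the free group on `A₀ ∪ {a, b, t, y}`, the letter `t`
taking the place of `u`. -/
def toFree (hφ : φ ⟨u A₀, Subgroup.mem_zpowers (u A₀)⟩ = ⟨v A₀, Subgroup.mem_zpowers (v A₀)⟩) :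
    Ext A₀ φ →* Base A₀ :=
  lift (baseLift (fun i => FreeGroup.of (Sum.inl i)) (a A₀) (b A₀)
    ((u A₀)⁻¹ * v A₀ * u A₀) (y A₀)) (u A₀)
    (mul_eq_mul_of_mem_zpowers hφ (by
      rw [baseLift_u, baseLift_v, ← v_eq_quadWord, mul_assoc, mul_inv_cancel_left]))

theorem toFree_injective
    (hφ : φ ⟨u A₀, Subgroup.mem_zpowers (u A₀)⟩ = ⟨v A₀, Subgroup.mem_zpowers (v A₀)⟩) :
    Function.Injective (toFree hφ) := by
  let g : Base A₀ →* Ext A₀ φ := baseLift (fun i => ofH A₀ φ (FreeGroup.of (Sum.inl i)))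
    (ofH A₀ φ (a A₀)) (ofH A₀ φ (b A₀)) t (ofH A₀ φ (y A₀))
  have : g.comp (toFree hφ) = MonoidHom.id _ := by
    apply hom_ext
    · apply base_hom_ext
      · simp [g, toFree, ofH]
      · simp [g, toFree, ofH]
      · simp [g, toFree, ofH]
      · simp only [toFree, MonoidHom.comp_apply, lift_of, baseLift_u, MonoidHom.id_apply]
        rw [map_mul, map_mul, map_inv, baseLift_u, baseLift_v, ← map_quadWord, ← v_eq_quadWord,
          mul_assoc, ← t_mul_u hφ, inv_mul_cancel_left]
        rfl
      · simp [g, toFree, ofH]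
    · simp [g, toFree]
  exact Function.LeftInverse.injective (DFunLike.congr_fun this)

theorem eq_of_isConj_quadWord
    (hφ : φ ⟨u A₀, Subgroup.mem_zpowers (u A₀)⟩ = ⟨v A₀, Subgroup.mem_zpowers (v A₀)⟩)
    {x : Ext A₀ φ}
    (h : IsConj (ofH A₀ φ (u A₀)) (quadWord (ofH A₀ φ (a A₀)) (ofH A₀ φ (b A₀)) x)) :
    x = ofH A₀ φ (y A₀) ∨ x = (ofH A₀ φ (y A₀))⁻¹ := by
  have h1 : IsConj (ofH A₀ φ (u A₀)) (ofH A₀ φ (v A₀)) :=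
    isConj_iff.2 ⟨t, by rw [t_mul_u hφ, mul_inv_cancel_right]⟩
  have hv : ofH A₀ φ (v A₀) = quadWord (ofH A₀ φ (a A₀)) (ofH A₀ φ (b A₀)) (ofH A₀ φ (y A₀)) :=
    map_quadWord (ofH A₀ φ) _ _ _
  rw [hv] at h1
  have h2 := (toFree hφ).map_isConj (h.symm.trans h1)
  have hA : toFree hφ (ofH A₀ φ (a A₀)) = a A₀ := by simp [toFree, ofH]
  have hB : toFree hφ (ofH A₀ φ (b A₀)) = b A₀ := by simp [toFree, ofH]
  have hY : toFree hφ (ofH A₀ φ (y A₀)) = y A₀ := by simp [toFree, ofH]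
  rw [map_quadWord, map_quadWord, hA, hB, hY] at h2
  rcases FreeGroup.eq_of_isConj_quadWord (by simp) (by simp) (by simp) h2 with h3 | h3
  · exact Or.inl (toFree_injective hφ (h3.trans hY.symm))
  · exact Or.inr (toFree_injective hφ (by rw [h3, map_inv, hY]; rfl))

/-- The automorphism-to-be of the extension fixing `A` and inverting `y`. -/
def invertY [DecidableEq A₀]
    (hφ : φ ⟨u A₀, Subgroup.mem_zpowers (u A₀)⟩ = ⟨v A₀, Subgroup.mem_zpowers (v A₀)⟩) :
    Ext A₀ φ →* Ext A₀ φ :=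
  lift ((ofH A₀ φ).comp (FreeGroup.flip (Sum.inr 3)))
    (ofH A₀ φ (a A₀ * y A₀ * b A₀ * y A₀)⁻¹ * t) (mul_eq_mul_of_mem_zpowers hφ (by
      have h1 : FreeGroup.flip (Sum.inr 3) (u A₀) = u A₀ := by simp [FreeGroup.flip, u]
      have h2 : FreeGroup.flip (Sum.inr 3) (v A₀) =
          (a A₀ * y A₀ * b A₀ * y A₀)⁻¹ * v A₀ * (a A₀ * y A₀ * b A₀ * y A₀) := by
        simp [FreeGroup.flip, v, a, b, y, mul_assoc]
      rw [MonoidHom.comp_apply, MonoidHom.comp_apply, h1, h2, mul_assoc, t_mul_u hφ, ← mul_assoc,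
        ← mul_assoc, ← map_mul, ← map_mul, mul_inv_cancel_right]))

theorem invertY_ofH [DecidableEq A₀]
    (hφ : φ ⟨u A₀, Subgroup.mem_zpowers (u A₀)⟩ = ⟨v A₀, Subgroup.mem_zpowers (v A₀)⟩)
    (h : Base A₀) : invertY hφ (ofH A₀ φ h) = ofH A₀ φ (FreeGroup.flip (Sum.inr 3) h) :=
  lift_of ..

theorem invertY_bijective [DecidableEq A₀]
    (hφ : φ ⟨u A₀, Subgroup.mem_zpowers (u A₀)⟩ = ⟨v A₀, Subgroup.mem_zpowers (v A₀)⟩) :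
    Function.Bijective (invertY hφ) := by
  let c : Subgroup.zpowers (u A₀) := ⟨u A₀, Subgroup.mem_zpowers (u A₀)⟩
  have hc : ∀ x, c⁻¹ * x = x * c⁻¹ := fun x => mul_comm' _ _
  have : (invertY hφ).comp (invertY hφ) = shift φ c⁻¹ hc := by
    apply hom_ext
    · refine MonoidHom.ext fun h => ?_
      change invertY hφ (invertY hφ (ofH A₀ φ h)) = shift φ c⁻¹ hc (of h)
      rw [invertY_ofH, invertY_ofH, FreeGroup.flip_flip, shift_of]
      rfl
    · have h1 : FreeGroup.flip (Sum.inr 3) (a A₀ * y A₀ * b A₀ * y A₀)⁻¹ *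
          (a A₀ * y A₀ * b A₀ * y A₀)⁻¹ = (v A₀)⁻¹ := by
        simp [FreeGroup.flip, v, a, b, y, mul_assoc]
      have h2 : invertY hφ t = ofH A₀ φ (a A₀ * y A₀ * b A₀ * y A₀)⁻¹ * t := lift_t ..
      rw [MonoidHom.comp_apply, h2, map_mul, invertY_ofH, h2, ← mul_assoc, ← map_mul, h1,
        shift_t, map_inv, inv_mul_eq_iff_eq_mul, ← mul_assoc, ← t_mul_u hφ]
      simp [c, ofH]
  have h : Function.Bijective (invertY hφ ∘ invertY hφ) := by
    rw [← MonoidHom.coe_comp, this]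
    exact shift_bijective _ _
  exact ⟨h.1.of_comp, h.2.of_comp⟩

end HNNCounterexample

namespace HNNCounterexample

open HNNExtension

variable {A₀ : Type} {φ : ↥(Subgroup.zpowers (u A₀)) ≃* ↥(Subgroup.zpowers (v A₀))}

theorem of_inl_mem_A (i : A₀) : FreeGroup.of (Sum.inl i) ∈ A A₀ :=
  Subgroup.subset_closure (Or.inl ⟨i, rfl⟩)

theorem a_mem_A : a A₀ ∈ A A₀ := Subgroup.subset_closure (Or.inr (by simp))

theorem b_mem_A : b A₀ ∈ A A₀ := Subgroup.subset_closure (Or.inr (by simp))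

theorem u_mem_A : u A₀ ∈ A A₀ := Subgroup.subset_closure (Or.inr (by simp))

theorem flip_eq_of_mem_A [DecidableEq A₀] {h : Base A₀} (hh : h ∈ A A₀) :
    FreeGroup.flip (Sum.inr 3) h = h := by
  have : A A₀ ≤ (FreeGroup.flip (Sum.inr 3)).eqLocus (MonoidHom.id _) := by
    refine (Subgroup.closure_le _).2 ?_
    rintro _ (⟨i, rfl⟩ | rfl | rfl | rfl) <;>
      simp [MonoidHom.eqLocus, FreeGroup.flip, a, b, u]
  exact this hh

theorem mem_A_of_flip_eq [DecidableEq A₀] {h : Base A₀} (hh : FreeGroup.flip (Sum.inr 3) h = h) :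
    h ∈ A A₀ := by
  have h1 := FreeGroup.mem_supported_of_flip_eq hh
  rw [FreeGroup.supported_eq_closure] at h1
  refine (Subgroup.closure_le _).2 ?_ h1
  rintro _ ⟨i | i, hi, rfl⟩
  · exact of_inl_mem_A i
  · fin_cases i
    exacts [a_mem_A, b_mem_A, u_mem_A, absurd rfl hi]

theorem racl_subset_range
    (hφ : φ ⟨u A₀, Subgroup.mem_zpowers (u A₀)⟩ = ⟨v A₀, Subgroup.mem_zpowers (v A₀)⟩) :
    racl (((A A₀).map (ofH A₀ φ) : Subgroup (Ext A₀ φ)) : Set (Ext A₀ φ)) ⊆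
      ((ofH A₀ φ).range : Set (Ext A₀ φ)) := by
  intro f hf
  let c : Subgroup.zpowers (u A₀) := ⟨u A₀, Subgroup.mem_zpowers (u A₀)⟩
  have hc : ∀ k : ℤ, ∀ x, c ^ k * x = x * c ^ k := fun k x => mul_comm' _ _
  obtain ⟨k, l, hkl, h⟩ : ∃ k l : ℤ, k ≠ l ∧
      shift φ (c ^ k) (hc k) f = shift φ (c ^ l) (hc l) f := by
    by_contra! hne
    have hinj : Function.Injective fun k : ℤ => shift φ (c ^ k) (hc k) f :=
      fun k l h => not_not.1 fun hkl => hne k l hkl h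
    refine (Set.infinite_range_of_injective hinj) (Set.Finite.subset hf ?_)
    rintro _ ⟨k, rfl⟩
    refine ⟨MulEquiv.ofBijective (shift φ (c ^ k) (hc k)) (shift_bijective _ _), ?_, rfl⟩
    rintro _ ⟨g, -, rfl⟩
    exact shift_of (c ^ k) (hc k) g
  have h1 : shift φ (c ^ (l - k)) (hc _) f = f := by
    apply (shift_bijective (c ^ k) (hc k)).1
    rw [shift_shift _ _ _ _ (fun x => mul_comm' _ _), h]
    simp only [← zpow_add, add_sub_cancel]
  exact mem_range_of_shift_eq A₀ φ hφ (sub_ne_zero.2 hkl.symm) _ h1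

theorem rdcl_inter_range_subset
    (hφ : φ ⟨u A₀, Subgroup.mem_zpowers (u A₀)⟩ = ⟨v A₀, Subgroup.mem_zpowers (v A₀)⟩) :
    rdcl (((A A₀).map (ofH A₀ φ) : Subgroup (Ext A₀ φ)) : Set (Ext A₀ φ)) ∩
      ((ofH A₀ φ).range : Set (Ext A₀ φ)) ⊆
      (((A A₀).map (ofH A₀ φ) : Subgroup (Ext A₀ φ)) : Set (Ext A₀ φ)) := by
  classical
  rintro _ ⟨hf, h, rfl⟩
  have h1 : invertY hφ (ofH A₀ φ h) = ofH A₀ φ h :=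
    hf (MulEquiv.ofBijective (invertY hφ) (invertY_bijective hφ)) (by
      rintro _ ⟨g, hg, rfl⟩
      exact (invertY_ofH hφ g).trans (congrArg _ (flip_eq_of_mem_A hg)))
  rw [invertY_ofH] at h1
  exact ⟨h, mem_A_of_flip_eq (of_injective φ h1), rfl⟩

theorem range_subset_aclE
    (hφ : φ ⟨u A₀, Subgroup.mem_zpowers (u A₀)⟩ = ⟨v A₀, Subgroup.mem_zpowers (v A₀)⟩) :
    ((ofH A₀ φ).range : Set (Ext A₀ φ)) ⊆
      aclE (((A A₀).map (ofH A₀ φ) : Subgroup (Ext A₀ φ)) : Set (Ext A₀ φ)) := by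
  rintro _ ⟨h, rfl⟩
  let P : Set (Ext A₀ φ) := ((A A₀).map (ofH A₀ φ) : Subgroup (Ext A₀ φ))
  let param (g : Base A₀) (hg : g ∈ A A₀) : FreeGroup ((↥P ⊕ Fin 1) ⊕ Fin 2) :=
    FreeGroup.of (.inl (.inl ⟨ofH A₀ φ g, g, hg, rfl⟩))
  let var (i : Fin 2) : FreeGroup ((↥P ⊕ Fin 1) ⊕ Fin 2) := FreeGroup.of (.inr i)
  let θ : Base A₀ →* FreeGroup ((↥P ⊕ Fin 1) ⊕ Fin 2) :=
    baseLift (fun i => param _ (of_inl_mem_A i)) (param _ a_mem_A) (param _ b_mem_A)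
      (param _ u_mem_A) (var 0)
  let subst (x : Ext A₀ φ) : Base A₀ →* Ext A₀ φ :=
    baseLift (fun i => ofH A₀ φ (FreeGroup.of (Sum.inl i))) (ofH A₀ φ (a A₀)) (ofH A₀ φ (b A₀))
      (ofH A₀ φ (u A₀)) x
  have hθ (c : Ext A₀ φ) (xs : Fin 2 → Ext A₀ φ) (g : Base A₀) :
      FreeGroup.lift (Sum.elim (Sum.elim Subtype.val fun _ => c) xs) (θ g) = subst (xs 0) g := by
    simp only [θ, subst, map_baseLift, param, var, FreeGroup.lift_apply_of, Sum.elim_inl,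
      Sum.elim_inr]
  have hsubst : subst (ofH A₀ φ (y A₀)) = ofH A₀ φ := by
    apply base_hom_ext <;> simp [subst]
  obtain ⟨ψ, hψ, hiff⟩ := exists_isExistential_realize_iff (A := P)
    (var 1 * θ (u A₀) * (var 1)⁻¹ * (θ (v A₀))⁻¹) ((FreeGroup.of (.inl (.inr 0)))⁻¹ * θ h)
  have hiff' (c : Ext A₀ φ) : ψ.Realize (Sum.elim Subtype.val fun _ => c) ↔
      ∃ xs : Fin 2 → Ext A₀ φ, xs 1 * ofH A₀ φ (u A₀) * (xs 1)⁻¹ =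
        quadWord (ofH A₀ φ (a A₀)) (ofH A₀ φ (b A₀)) (xs 0) ∧ c = subst (xs 0) h := by
    rw [hiff]
    refine exists_congr fun xs => ?_
    rw [map_mul, map_mul, map_mul, map_inv, map_inv, map_mul, map_inv, hθ, hθ, hθ, mul_inv_eq_one,
      inv_mul_eq_one]
    simp [var, subst]
  refine ⟨ψ, hψ, (Set.toFinite {subst (ofH A₀ φ (y A₀)) h,
    subst (ofH A₀ φ (y A₀))⁻¹ h}).subset ?_, ?_⟩
  · intro c hc
    obtain ⟨xs, h1, rfl⟩ := (hiff' c).1 hc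
    rcases eq_of_isConj_quadWord hφ (isConj_iff.2 ⟨_, h1⟩) with h2 | h2 <;> simp [h2]
  · refine (hiff' _).2 ⟨![ofH A₀ φ (y A₀), t], ?_, ?_⟩
    · simp only [Matrix.cons_val_zero, Matrix.cons_val_one]
      rw [t_mul_u hφ, mul_inv_cancel_right]
      exact map_quadWord (ofH A₀ φ) _ _ _
    · simp only [Matrix.cons_val_zero, hsubst]

end HNNCounterexample

open HNNCounterexample in
/-- With `H` the free group on `A₀ ∪ {a,b,u,y}`, `A = ⟨A₀,a,b,u⟩`,
`v = a y b y a y⁻¹ b y⁻¹` and `F = ⟨H, t | u^t = v⟩` the HNN extension of `H` along the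
isomorphism `⟨u⟩ ≃ ⟨v⟩` sending `u` to `v`, computing closures in `F` (identifying `H`
and `A` with their images in `F`) we have `acl(A) = acl^∃(A) = H` and
`dcl(A) = dcl^∃(A) = A`. -/
theorem hnn_counterexample_closures (A₀ : Type) [Finite A₀]
    (φ : ↥(Subgroup.zpowers (u A₀)) ≃* ↥(Subgroup.zpowers (v A₀)))
    (hφ : φ ⟨u A₀, Subgroup.mem_zpowers (u A₀)⟩ = ⟨v A₀, Subgroup.mem_zpowers (v A₀)⟩) :
    acl (((A A₀).map (ofH A₀ φ) : Subgroup (Ext A₀ φ)) : Set (Ext A₀ φ)) =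
      ((ofH A₀ φ).range : Set (Ext A₀ φ)) ∧
    aclE (((A A₀).map (ofH A₀ φ) : Subgroup (Ext A₀ φ)) : Set (Ext A₀ φ)) =
      ((ofH A₀ φ).range : Set (Ext A₀ φ)) ∧
    dcl (((A A₀).map (ofH A₀ φ) : Subgroup (Ext A₀ φ)) : Set (Ext A₀ φ)) =
      (((A A₀).map (ofH A₀ φ) : Subgroup (Ext A₀ φ)) : Set (Ext A₀ φ)) ∧
    dclE (((A A₀).map (ofH A₀ φ) : Subgroup (Ext A₀ φ)) : Set (Ext A₀ φ)) =
      (((A A₀).map (ofH A₀ φ) : Subgroup (Ext A₀ φ)) : Set (Ext A₀ φ)) := by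
  have h1 := acl_subset_racl.trans (racl_subset_range hφ)
  have h2 := range_subset_aclE hφ
  have h3 : dcl (((A A₀).map (ofH A₀ φ) : Subgroup (Ext A₀ φ)) : Set (Ext A₀ φ)) ⊆
      (((A A₀).map (ofH A₀ φ) : Subgroup (Ext A₀ φ)) : Set (Ext A₀ φ)) := fun x hx =>
    rdcl_inter_range_subset hφ ⟨dcl_subset_rdcl hx, h1 (Ldcl_subset_Lacl hx)⟩
  exact ⟨h1.antisymm (h2.trans LaclE_subset_Lacl), (LaclE_subset_Lacl.trans h1).antisymm h2,
    h3.antisymm (subset_dclE.trans LdclE_subset_Ldcl),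
    (LdclE_subset_Ldcl.trans h3).antisymm subset_dclE⟩
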